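/- arXiv:1409.7177 — 2 statements merged into one kernel-verified Lean document; each statement's English description precedes it below -/
import Mathlib

section
/- Let V be a finite-dimensional real inner product space, let A and S be symmetric (self-adjoint) endomorphisms of V, let φ be a skew-symmetric endomorphism of V, and let α be a nonzero real number. If S A = A S and 2(φ S − S φ) + α (A φ S − A S φ) = 0 (as endomorphisms of V), then A(φ S − S φ) = (φ S − S φ)A. -/
open scoped RealInnerProductSpace

theorem shape_commutes_with_phiS_minus_Sphi
    {V : Type*} [NormedAddCommGroup V] [InnerProductSpace ℝ V]
    [FiniteDimensional ℝ V]
    (A S φ : V →ₗ[ℝ] V) (α : ℝ) (hα : α ≠ 0)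
    (hA : ∀ X Y : V, ⟪A X, Y⟫ = ⟪X, A Y⟫)
    (hS : ∀ X Y : V, ⟪S X, Y⟫ = ⟪X, S Y⟫)
    (hφ : ∀ X Y : V, ⟪φ X, Y⟫ = -⟪X, φ Y⟫)
    (hSA : S * A = A * S)
    (heq : (2 : ℝ) • (φ * S - S * φ) + α • (A * φ * S - A * S * φ) = 0) :
    A * (φ * S - S * φ) = (φ * S - S * φ) * A := by
  have hB : ∀ X Y : V, ⟪(φ * S - S * φ) X, Y⟫ = ⟪X, (φ * S - S * φ) Y⟫ := by
    intro X Y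
    simp only [LinearMap.sub_apply, Module.End.mul_apply, inner_sub_left, inner_sub_right,
      hφ, hS]
    have h1 := hφ X (S Y)
    have h2 := hS X (φ Y)
    linarith
  have heq2 : (2 : ℝ) • (φ * S - S * φ) + α • (A * (φ * S - S * φ)) = 0 := by
    rw [mul_sub, ← mul_assoc, ← mul_assoc]
    exact heq
  generalize φ * S - S * φ = B at hB heq2
  have key : ∀ X Y : V, 2 * ⟪B X, Y⟫ + α * ⟪A (B X), Y⟫ = 0 := by
    intro X Y
    have h := congrArg (fun T : V →ₗ[ℝ] V => ⟪T X, Y⟫) heq2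
    simpa [inner_add_left, real_inner_smul_left] using h
  ext X
  refine ext_inner_right ℝ fun Y => ?_
  simp only [Module.End.mul_apply]
  have h1 := key X Y
  have h2 := key Y X
  have h3 : ⟪B (A X), Y⟫ = ⟪A (B Y), X⟫ := by
    rw [hB, hA, real_inner_comm, hA]
  have h4 : ⟪B X, Y⟫ = ⟪B Y, X⟫ := by
    rw [hB, real_inner_comm]
  rw [h3]
  apply mul_left_cancel₀ hα
  rw [h4] at h1
  linarith
end

section
/- Let V be a finite-dimensional real inner product space, let A and S be symmetric (self-adjoint) endomorphisms of V, let φ be a skew-symmetric endomorphism of V, and let h be a real number. Suppose that A(φ S − S φ) = (φ S − S φ)A and that S(φ X) − φ(S X) = h A(φ X) − A²(φ X) − h φ(A X) + φ(A² X) for every X ∈ V. Then S φ = φ S, i.e. S(φ X) = φ(S X) for every X ∈ V. -/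
open scoped RealInnerProductSpace

theorem ricci_commutes_with_phi
    {V : Type*} [NormedAddCommGroup V] [InnerProductSpace ℝ V]
    [FiniteDimensional ℝ V]
    (A S φ : V →ₗ[ℝ] V) (h : ℝ)
    (hA : ∀ X Y : V, ⟪A X, Y⟫ = ⟪X, A Y⟫)
    (hS : ∀ X Y : V, ⟪S X, Y⟫ = ⟪X, S Y⟫)
    (hφ : ∀ X Y : V, ⟪φ X, Y⟫ = -⟪X, φ Y⟫)
    (hcomm : A * (φ * S - S * φ) = (φ * S - S * φ) * A)
    (heq : ∀ X : V, S (φ X) - φ (S X)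
        = h • (A (φ X)) - A (A (φ X)) - h • (φ (A X)) + φ (A (A X))) :
    ∀ X : V, S (φ X) = φ (S X) := by
  obtain ⟨C, hC⟩ : ∃ C : V →ₗ[ℝ] V, C = φ * S - S * φ := ⟨_, rfl⟩
  obtain ⟨B, hB⟩ : ∃ B : V →ₗ[ℝ] V, B = h • A - A * A := ⟨_, rfl⟩
  rw [← hC] at hcomm
  have hCB : C = φ * B - B * φ := by
    ext X
    have := heq X
    have h2 : φ (S X) - S (φ X) = -(S (φ X) - φ (S X)) := by abel
    simp only [hC, hB, LinearMap.sub_apply, Module.End.mul_apply, LinearMap.smul_apply,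
      map_sub, map_smul]
    rw [h2, this]
    abel
  have hBC : B * C = C * B := by
    rw [hB, sub_mul, mul_sub, smul_mul_assoc, mul_smul_comm, hcomm, mul_assoc, hcomm,
      ← mul_assoc, hcomm, mul_assoc]
  have htr : LinearMap.trace ℝ V (C * C) = 0 := by
    have e : C * C = C * φ * B - B * (C * φ) := by
      conv_lhs => rw [hCB, ← hCB]
      rw [← mul_assoc, hBC]
      conv_lhs => rhs; rw [hCB]
      rw [mul_sub, mul_assoc, mul_assoc]
    rw [e, map_sub, LinearMap.trace_mul_comm, sub_self]
  have hsym : ∀ X Y : V, ⟪C X, Y⟫ = ⟪X, C Y⟫ := by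
    intro X Y
    simp only [hC, LinearMap.sub_apply, Module.End.mul_apply, inner_sub_left, inner_sub_right,
      hφ, hS]
    rw [← hS X (φ Y)]
    have := hφ X (S Y)
    have := hφ (S X) Y
    linarith
  have b := stdOrthonormalBasis ℝ V
  rw [LinearMap.trace_eq_sum_inner _ b] at htr
  have hz : ∀ i, C (b i) = 0 := by
    have h1 : ∀ i, ⟪b i, (C * C) (b i)⟫ = ⟪C (b i), C (b i)⟫ := fun i => by
      rw [Module.End.mul_apply, ← hsym]
    simp only [h1] at htr
    rw [Finset.sum_eq_zero_iff_of_nonneg (fun i _ => real_inner_self_nonneg)] at htr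
    intro i
    exact inner_self_eq_zero.mp (htr i (Finset.mem_univ i))
  have hC0 : C = 0 := b.toBasis.ext (fun i => by simpa using hz i)
  intro X
  have : C X = 0 := by rw [hC0]; rfl
  rw [hC] at this
  exact (sub_eq_zero.mp this).symm
end
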